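/- A deep sub-sampled GaussNet followed by global average pooling is translation insensitive: let K₁ : ℤ² → ℝ be Lipschitz with constant L, let K₂, …, K_n : ℤ² → ℝ be kernels with ∑_{a} |K_i(a)| ≤ B_i for i = 2, …, n, let d₁, …, d_n ≥ 1 be strides, let f_i[J](x) = r(∑_{y} K_i(d_i·x − y)·J(y)), and let I : ℤ² → ℝ be finitely supported. Then for any nonempty finite set F ⊆ ℤ² of N pixels and F[I] = (1/N)·∑_{x ∈ F} (f_n ∘ ⋯ ∘ f_1)[I](x), every shift s ∈ ℤ² satisfies |F[T_s I] − F[I]| ≤ C·‖s‖ with C = L · (∑_{y} |I(y)|) · ∏_{i=2}^{n} B_i. -/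

import Mathlib

/-- Euclidean norm of an integer shift `s ∈ ℤ²`. -/
noncomputable def znorm (s : ℤ × ℤ) : ℝ :=
  Real.sqrt ((s.1 : ℝ) ^ 2 + (s.2 : ℝ) ^ 2)

/-- Translation of an image by `s`: `(T_s I)(x) = I(x + s)`. -/
def Tshift (s : ℤ × ℤ) (I : ℤ × ℤ → ℝ) : ℤ × ℤ → ℝ :=
  fun x => I (x + s)

/-- Rectified linear unit `r(t) = max(t, 0)`. -/
def relu (t : ℝ) : ℝ := max t 0

/-- Sub-sampled GaussNet layer with kernel `K` and stride `d`:
`f[J](x) = r(∑_{y} K(d·x − y)·J(y))`. -/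
noncomputable def subLayer (K : ℤ × ℤ → ℝ) (d : ℤ) (J : ℤ × ℤ → ℝ) : ℤ × ℤ → ℝ :=
  fun x => relu (∑' y : ℤ × ℤ, K (d • x - y) * J y)

/-- The composition of sub-sampled GaussNet layers described by a list of triples
`(Kᵢ, dᵢ, Bᵢ)` (kernel, stride, bound), applied in order to the input. -/
noncomputable def subNet (layers : List ((ℤ × ℤ → ℝ) × ℤ × ℝ)) (J : ℤ × ℤ → ℝ) :
    ℤ × ℤ → ℝ :=
  layers.foldl (fun J' p => subLayer p.1 p.2.1 J') J

theorem abs_relu_sub_relu_le (a b : ℝ) : |relu a - relu b| ≤ |a - b| :=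
  abs_max_sub_max_le_abs a b 0

/-- Summability of `K (d • x - y) * J y` need not hold, but it holds for `J` iff it holds for `J'`,
and if it fails both layers return `0`. -/
theorem abs_subLayer_sub_le {K : ℤ × ℤ → ℝ} {B M : ℝ} (d : ℤ) {J J' : ℤ × ℤ → ℝ}
    (hK : Summable fun a => |K a|) (hB : ∑' a, |K a| ≤ B) (h : ∀ x, |J x - J' x| ≤ M)
    (x : ℤ × ℤ) : |subLayer K d J x - subLayer K d J' x| ≤ B * M := by
  have hM : 0 ≤ M := (abs_nonneg _).trans (h 0)
  have hsum : Summable fun y => |K (d • x - y)| :=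
    (Equiv.subLeft (d • x)).summable_iff.mpr hK
  have htsum : ∑' y, |K (d • x - y)| = ∑' a, |K a| :=
    (Equiv.subLeft (d • x)).tsum_eq fun a => |K a|
  have hle (y : ℤ × ℤ) : ‖K (d • x - y) * J y - K (d • x - y) * J' y‖ ≤ |K (d • x - y)| * M := by
    rw [← mul_sub, norm_mul, Real.norm_eq_abs, Real.norm_eq_abs]
    exact mul_le_mul_of_nonneg_left (h y) (abs_nonneg _)
  have hdiff : Summable fun y => K (d • x - y) * J y - K (d • x - y) * J' y :=
    .of_norm_bounded (hsum.mul_right M) hle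
  refine (abs_relu_sub_relu_le _ _).trans ?_
  by_cases hJ' : Summable fun y => K (d • x - y) * J' y
  · have hJ : Summable fun y => K (d • x - y) * J y := by
      simpa using hdiff.add hJ'
    rw [← hJ.tsum_sub hJ', ← Real.norm_eq_abs]
    refine (tsum_of_norm_bounded (hsum.mul_right M).hasSum hle).trans ?_
    rw [tsum_mul_right, htsum]
    exact mul_le_mul_of_nonneg_right hB hM
  · have hJ : ¬ Summable fun y => K (d • x - y) * J y := fun hJ =>
      hJ' (by simpa using hJ.sub hdiff)
    rw [tsum_eq_zero_of_not_summable hJ, tsum_eq_zero_of_not_summable hJ', sub_zero, abs_zero]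
    exact mul_nonneg ((tsum_nonneg fun _ => abs_nonneg _).trans hB) hM

theorem abs_subNet_sub_le {layers : List ((ℤ × ℤ → ℝ) × ℤ × ℝ)}
    (hl : ∀ p ∈ layers, Summable (fun a => |p.1 a|) ∧ ∑' a, |p.1 a| ≤ p.2.2)
    {J J' : ℤ × ℤ → ℝ} {M : ℝ} (h : ∀ x, |J x - J' x| ≤ M) (x : ℤ × ℤ) :
    |subNet layers J x - subNet layers J' x| ≤ M * (layers.map fun p => p.2.2).prod := by
  induction layers generalizing J J' M with
  | nil => simpa [subNet] using h x
  | cons p l ih =>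
    obtain ⟨hp, hl⟩ := List.forall_mem_cons.mp hl
    have := ih hl (abs_subLayer_sub_le p.2.1 hp.1 hp.2 h)
    rw [List.map_cons, List.prod_cons, ← mul_assoc, mul_comm M]
    exact this

theorem abs_subLayer_Tshift_sub_le {K : ℤ × ℤ → ℝ} {L : ℝ}
    (hK : ∀ a b : ℤ × ℤ, |K a - K b| ≤ L * znorm (a - b)) (d : ℤ)
    {I : ℤ × ℤ → ℝ} (hI : (Function.support I).Finite) (s x : ℤ × ℤ) :
    |subLayer K d (Tshift s I) x - subLayer K d I x| ≤ L * znorm s * ∑' y, |I y| := by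
  have hsum (f : ℤ × ℤ → ℝ) : Summable fun y => f y * I y :=
    summable_of_hasFiniteSupport (hI.subset (Function.support_mul_subset_right _ _))
  have habs : Summable fun y => |I y| :=
    summable_of_hasFiniteSupport (hI.subset fun y hy => by simpa using hy)
  have hshift : ∑' y, K (d • x - y) * Tshift s I y = ∑' y, K (d • x - y + s) * I y := by
    rw [← (Equiv.addRight s).tsum_eq fun y => K (d • x - y + s) * I y]
    refine tsum_congr fun y => ?_
    simp only [Tshift, Equiv.coe_addRight]
    congr 2
    abel
  refine (abs_relu_sub_relu_le _ _).trans ?_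
  rw [hshift, ← (hsum _).tsum_sub (hsum _), ← Real.norm_eq_abs, ← tsum_mul_left]
  refine tsum_of_norm_bounded (habs.mul_left _).hasSum fun y => ?_
  rw [← sub_mul, norm_mul, Real.norm_eq_abs, Real.norm_eq_abs]
  refine mul_le_mul_of_nonneg_right ?_ (abs_nonneg _)
  simpa using hK (d • x - y + s) (d • x - y)

theorem abs_average_sub_average_le {α : Type*} {F : Finset α} (hF : F.Nonempty) {f g : α → ℝ}
    {C : ℝ} (h : ∀ x, |f x - g x| ≤ C) :
    |(F.card : ℝ)⁻¹ * ∑ x ∈ F, f x - (F.card : ℝ)⁻¹ * ∑ x ∈ F, g x| ≤ C := by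
  have hpos : (0 : ℝ) < F.card := by exact_mod_cast hF.card_pos
  rw [← mul_sub, ← Finset.sum_sub_distrib, abs_mul, abs_of_pos (inv_pos.mpr hpos),
    inv_mul_le_iff₀ hpos]
  calc |∑ x ∈ F, (f x - g x)| ≤ ∑ x ∈ F, |f x - g x| := Finset.abs_sum_le_sum_abs _ _
    _ ≤ F.card * C := by simpa using Finset.sum_le_card_nsmul F _ C fun x _ => h x

/-- A deep sub-sampled GaussNet followed by global average pooling is
translation insensitive: with a first layer whose kernel `K₁` is `L`-Lipschitz and
stride `d₁ ≥ 1`, followed by layers with kernels satisfying `∑_a |Kᵢ(a)| ≤ Bᵢ` and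
strides `dᵢ ≥ 1`, for a finitely supported input `I`, a nonempty finite pixel set `F`
of `N` pixels, and `F[I] = (1/N)·∑_{x∈F} (f_n ∘ ⋯ ∘ f_1)[I](x)`, every shift `s`
satisfies `|F[T_s I] − F[I]| ≤ C·‖s‖` with `C = L·(∑_y |I(y)|)·∏ᵢ Bᵢ`. -/
theorem deep_subNet_pooling_insensitive (K₁ : ℤ × ℤ → ℝ) (L : ℝ)
    (hK₁ : ∀ a b : ℤ × ℤ, |K₁ a - K₁ b| ≤ L * znorm (a - b))
    (d₁ : ℤ) (hd₁ : 1 ≤ d₁)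
    (rest : List ((ℤ × ℤ → ℝ) × ℤ × ℝ))
    (hrest : ∀ p ∈ rest, 1 ≤ p.2.1 ∧ Summable (fun a : ℤ × ℤ => |p.1 a|) ∧
      (∑' a : ℤ × ℤ, |p.1 a|) ≤ p.2.2)
    (I : ℤ × ℤ → ℝ) (hI : (Function.support I).Finite)
    (F : Finset (ℤ × ℤ)) (hF : F.Nonempty) (s : ℤ × ℤ) :
    |(F.card : ℝ)⁻¹ * ∑ x ∈ F, subNet rest (subLayer K₁ d₁ (Tshift s I)) x -
        (F.card : ℝ)⁻¹ * ∑ x ∈ F, subNet rest (subLayer K₁ d₁ I) x| ≤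
      (L * (∑' y : ℤ × ℤ, |I y|) * (rest.map (fun p => p.2.2)).prod) * znorm s := by
  refine abs_average_sub_average_le hF fun x => ?_
  convert abs_subNet_sub_le (fun p hp => (hrest p hp).2)
    (abs_subLayer_Tshift_sub_le hK₁ d₁ hI s) x using 1
  ring
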